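/- For every alternating 4-linear form T on ℝ^n and all u, v, w, z ∈ ℝ^n, writing Q = ∑_{1≤k<l<α<β≤n} T(e_k,e_l,e_α,e_β) ĉ(e_k) ĉ(e_l) ĉ(e_α) ĉ(e_β), one has both ∫_{S^{n−1}} Tr( ∑_{i=1}^n ξ_i · ĉ(u) ĉ(v) ĉ(w) ĉ(z) c(e_i) Q c(ξ) ) dσ(ξ) = −T(u,v,w,z) · 2^n · vol(S^{n−1}) and ∫_{S^{n−1}} Tr( ∑_{i=1}^n ξ_i · ĉ(u) ĉ(v) ĉ(w) ĉ(z) Q c(e_i) c(ξ) ) dσ(ξ) = −T(u,v,w,z) · 2^n · vol(S^{n−1}). -/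

import Mathlib

open MeasureTheory

noncomputable section

/-- Euclidean space `ℝ^n` with its standard inner product. -/
abbrev Eucl (n : ℕ) := EuclideanSpace ℝ (Fin n)

/-- The exterior algebra `Λℝ^n`. -/
abbrev ExtAlg (n : ℕ) := ExteriorAlgebra ℝ (Eucl n)

/-- The standard orthonormal basis vector `e_i` of `ℝ^n`. -/
def e (n : ℕ) (i : Fin n) : Eucl n := EuclideanSpace.single i 1

/-- Left exterior multiplication `ε(x)` on `Λℝ^n`. -/
def eps {n : ℕ} (x : Eucl n) : Module.End ℝ (ExtAlg n) :=
  LinearMap.mulLeft ℝ (ExteriorAlgebra.ι ℝ x)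

/-- Interior multiplication (contraction) `ι(x)` on `Λℝ^n`, determined by the inner product. -/
def iot {n : ℕ} (x : Eucl n) : Module.End ℝ (ExtAlg n) :=
  CliffordAlgebra.contractLeft (Q := (0 : QuadraticForm ℝ (Eucl n))) (innerSL ℝ x).toLinearMap

/-- The Clifford action `c(x) = ε(x) − ι(x)`. -/
def c {n : ℕ} (x : Eucl n) : Module.End ℝ (ExtAlg n) := eps x - iot x

/-- The Clifford action `ĉ(x) = ε(x) + ι(x)`. -/
def hc {n : ℕ} (x : Eucl n) : Module.End ℝ (ExtAlg n) := eps x + iot x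

/-- The trace of a linear endomorphism of `Λℝ^n`. -/
def Tr {n : ℕ} : Module.End ℝ (ExtAlg n) →ₗ[ℝ] ℝ := LinearMap.trace ℝ (ExtAlg n)

/-- The surface measure `σ` on the unit sphere `S^{n-1} ⊆ ℝ^n`. -/
def sphMeasure (n : ℕ) : Measure (Metric.sphere (0 : Eucl n) 1) :=
  (volume : Measure (Eucl n)).toSphere

/-- The total surface measure `vol(S^{n-1})` of the unit sphere. -/
def volSph (n : ℕ) : ℝ := (sphMeasure n Set.univ).toReal

/-! ### Clifford relations -/

lemma iot_mul_eps {n : ℕ} (x y : Eucl n) :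
    iot x * eps y = inner ℝ x y • (1 : Module.End ℝ (ExtAlg n)) - eps y * iot x := by
  refine LinearMap.ext fun a => ?_
  exact CliffordAlgebra.contractLeft_ι_mul
    (Q := (0 : QuadraticForm ℝ (Eucl n))) (d := (innerSL ℝ x).toLinearMap) y a

lemma eps_mul_eps {n : ℕ} (x y : Eucl n) : eps x * eps y = -(eps y * eps x) := by
  refine LinearMap.ext fun a => ?_
  have h := ExteriorAlgebra.ι_add_mul_swap (R := ℝ) x y
  rw [← eq_neg_iff_add_eq_zero] at h
  simp [eps, ← mul_assoc, h]

lemma iot_mul_iot {n : ℕ} (x y : Eucl n) : iot x * iot y = -(iot y * iot x) := by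
  refine LinearMap.ext fun a => ?_
  exact CliffordAlgebra.contractLeft_comm (Q := (0 : QuadraticForm ℝ (Eucl n)))
    (d := (innerSL ℝ x).toLinearMap) (d' := (innerSL ℝ y).toLinearMap) a

lemma hc_mul_hc {n : ℕ} (x y : Eucl n) :
    hc x * hc y = (2 * inner ℝ x y) • (1 : Module.End ℝ (ExtAlg n)) - hc y * hc x := by
  have h := real_inner_comm x y
  simp only [hc, mul_add, add_mul, iot_mul_eps, eps_mul_eps x y, iot_mul_iot x y, h]
  module

lemma c_mul_hc {n : ℕ} (x y : Eucl n) : c x * hc y = (-1 : ℝ) • (hc y * c x) := by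
  have h := real_inner_comm x y
  simp only [c, hc, mul_add, add_mul, mul_sub, sub_mul, iot_mul_eps, eps_mul_eps x y,
    iot_mul_iot x y, h]
  module

lemma c_mul_self {n : ℕ} (x : Eucl n) :
    c x * c x = -(inner ℝ x x : ℝ) • (1 : Module.End ℝ (ExtAlg n)) := by
  have he : eps x * eps x = 0 := by
    refine LinearMap.ext fun a => ?_
    simp [eps, ← mul_assoc]
  have hi : iot x * iot x = 0 := by
    refine LinearMap.ext fun a => ?_
    exact CliffordAlgebra.contractLeft_contractLeft (Q := (0 : QuadraticForm ℝ (Eucl n)))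
      (d := (innerSL ℝ x).toLinearMap) a
  simp only [c, mul_sub, sub_mul, iot_mul_eps, he, hi]
  module

lemma sum_smul_c {n : ℕ} (x : Eucl n) : ∑ j : Fin n, x j • c (e n j) = c x := by
  let L : Eucl n →ₗ[ℝ] Module.End ℝ (ExtAlg n) :=
    { toFun := c
      map_add' := fun a b => by
        refine LinearMap.ext fun y => ?_
        simp only [c, eps, iot, LinearMap.sub_apply, LinearMap.add_apply, map_add,
          LinearMap.mulLeft_apply, add_mul, ContinuousLinearMap.toLinearMap_add]
        abel
      map_smul' := fun r a => by
        refine LinearMap.ext fun y => ?_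
        simp [c, eps, iot, smul_sub] }
  have hx : x = ∑ j : Fin n, x j • e n j := by
    simpa [e] using ((EuclideanSpace.basisFun (Fin n) ℝ).sum_repr x).symm
  calc ∑ j : Fin n, x j • c (e n j) = L (∑ j : Fin n, x j • e n j) := by simp [L]
    _ = c x := by rw [← hx]; rfl

lemma inner_e {n : ℕ} (x : Eucl n) (j : Fin n) : inner ℝ (e n j) x = x j :=
  (EuclideanSpace.inner_single_left j 1 x).trans (by simp)

lemma inner_e_e {n : ℕ} {i j : Fin n} (h : i ≠ j) : inner ℝ (e n i) (e n j) = 0 := by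
  rw [inner_e]
  simp [e, h]

/-! ### Traces of products of the operators `ĉ` -/

lemma Tr_one (n : ℕ) : Tr (1 : Module.End ℝ (ExtAlg n)) = 2 ^ n := by
  have b := (EuclideanSpace.basisFun (Fin n) ℝ).toBasis.ExteriorAlgebra
  have := Module.Finite.of_basis b
  refine (LinearMap.trace_one ℝ (ExtAlg n)).trans ?_
  rw [Module.finrank_eq_card_basis b]
  simp

lemma Tr_mul_comm {n : ℕ} (A B : Module.End ℝ (ExtAlg n)) : Tr (A * B) = Tr (B * A) :=
  LinearMap.trace_mul_comm ℝ A B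

/-- The signed sum of the contractions of `x` with the factors of `∏ ĉ(yᵢ)`. -/
def contractProd {n : ℕ} (x : Eucl n) : List (Eucl n) → Module.End ℝ (ExtAlg n)
  | [] => 0
  | y :: L => inner ℝ x y • (L.map hc).prod - hc y * contractProd x L

lemma hc_mul_prod {n : ℕ} (x : Eucl n) (L : List (Eucl n)) :
    hc x * (L.map hc).prod =
      (2 : ℝ) • contractProd x L + (-1 : ℝ) ^ L.length • ((L.map hc).prod * hc x) := by
  induction L with
  | nil => simp [contractProd]
  | cons y L ih =>
    rw [List.map_cons, List.prod_cons, ← mul_assoc, hc_mul_hc, sub_mul, mul_assoc, ih,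
      contractProd, List.length_cons, pow_succ, mul_assoc]
    simp only [mul_add, mul_smul_comm, smul_mul_assoc, one_mul]
    module

lemma Tr_hc_mul_prod {n : ℕ} (x : Eucl n) (L : List (Eucl n)) (hL : Odd L.length) :
    Tr (hc x * (L.map hc).prod) = Tr (contractProd x L) := by
  have h := congrArg Tr (hc_mul_prod x L)
  rw [hL.neg_one_pow, map_add, map_smul, map_smul, Tr_mul_comm _ (hc x), smul_eq_mul,
    smul_eq_mul] at h
  linarith

lemma Tr_hc_two {n : ℕ} (u a : Eucl n) : Tr (hc u * hc a) = 2 ^ n * inner ℝ a u := by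
  have h := Tr_hc_mul_prod a [u] ⟨0, rfl⟩
  simp only [List.map_cons, List.map_nil, List.prod_cons, List.prod_nil, mul_one, contractProd,
    mul_zero, sub_zero, map_smul, Tr_one, smul_eq_mul] at h
  rw [Tr_mul_comm, h, mul_comm]

lemma Tr_hc_four {n : ℕ} (u v a b : Eucl n) (hba : inner ℝ b a = 0) :
    Tr (hc u * hc v * hc a * hc b) =
      inner ℝ b u * Tr (hc v * hc a) - inner ℝ b v * Tr (hc u * hc a) := by
  have h := Tr_hc_mul_prod b [u, v, a] ⟨1, rfl⟩
  simp only [List.map_cons, List.map_nil, List.prod_cons, List.prod_nil, mul_one, contractProd,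
    mul_zero, sub_zero, hba, zero_smul, mul_smul_comm, map_sub, map_smul,
    smul_eq_mul, ← mul_assoc] at h
  rw [Tr_mul_comm, ← mul_assoc, ← mul_assoc, h]

lemma Tr_hc_six {n : ℕ} (u v w a b d : Eucl n) (hda : inner ℝ d a = 0) (hdb : inner ℝ d b = 0) :
    Tr (hc u * hc v * hc w * hc a * hc b * hc d) =
      inner ℝ d u * Tr (hc v * hc w * hc a * hc b) - inner ℝ d v * Tr (hc u * hc w * hc a * hc b)
        + inner ℝ d w * Tr (hc u * hc v * hc a * hc b) := by
  have h := Tr_hc_mul_prod d [u, v, w, a, b] ⟨2, rfl⟩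
  simp only [List.map_cons, List.map_nil, List.prod_cons, List.prod_nil, mul_one, contractProd,
    mul_zero, sub_zero, hda, hdb, zero_smul, mul_sub, mul_smul_comm, map_sub, map_smul,
    smul_eq_mul, ← mul_assoc] at h
  rw [Tr_mul_comm]
  simp only [← mul_assoc]
  rw [h]
  ring

lemma Tr_hc_eight {n : ℕ} (u v w z a b d f : Eucl n) (hfa : inner ℝ f a = 0)
    (hfb : inner ℝ f b = 0) (hfd : inner ℝ f d = 0) :
    Tr (hc u * hc v * hc w * hc z * hc a * hc b * hc d * hc f) =
      inner ℝ f u * Tr (hc v * hc w * hc z * hc a * hc b * hc d)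
        - inner ℝ f v * Tr (hc u * hc w * hc z * hc a * hc b * hc d)
        + inner ℝ f w * Tr (hc u * hc v * hc z * hc a * hc b * hc d)
        - inner ℝ f z * Tr (hc u * hc v * hc w * hc a * hc b * hc d) := by
  have h := Tr_hc_mul_prod f [u, v, w, z, a, b, d] ⟨3, rfl⟩
  simp only [List.map_cons, List.map_nil, List.prod_cons, List.prod_nil, mul_one, contractProd,
    mul_zero, sub_zero, hfa, hfb, hfd, zero_smul, mul_sub, mul_smul_comm, map_sub, map_smul,
    smul_eq_mul, ← mul_assoc] at h
  rw [Tr_mul_comm]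
  simp only [← mul_assoc]
  rw [h]
  ring

lemma Tr_hc_eight_eq_det {n : ℕ} (v : Fin 4 → Eucl n) (f : Fin 4 → Fin n)
    (hf : Function.Injective f) :
    Tr (hc (v 0) * hc (v 1) * hc (v 2) * hc (v 3) *
        (hc (e n (f 0)) * hc (e n (f 1)) * hc (e n (f 2)) * hc (e n (f 3)))) =
      2 ^ n * (Matrix.of fun i j => v j (f i)).det := by
  have h : ∀ i j, i ≠ j → inner ℝ (e n (f i)) (e n (f j)) = 0 := fun i j hij =>
    inner_e_e (hf.ne hij)
  simp only [← mul_assoc]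
  rw [Tr_hc_eight _ _ _ _ _ _ _ _ (h _ _ (by decide)) (h _ _ (by decide)) (h _ _ (by decide))]
  simp only [Tr_hc_six _ _ _ _ _ _ (h 2 0 (by decide)) (h 2 1 (by decide)),
    Tr_hc_four _ _ _ _ (h 1 0 (by decide)), Tr_hc_two, inner_e]
  simp [Matrix.det_succ_row_zero, Fin.sum_univ_succ, Fin.succAbove]
  ring

/-! ### Alternating sums over strictly increasing tuples -/

lemma sum_strictMono_sum_perm {m n : ℕ} {M : Type*} [AddCommMonoid M] (F : (Fin m → Fin n) → M)
    (hF : ∀ f, ¬ Function.Injective f → F f = 0) :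
    (∑ f : Fin m → Fin n, if StrictMono f then ∑ σ : Equiv.Perm (Fin m), F (f ∘ σ) else 0) =
      ∑ f, F f := by
  classical
  calc
    _ = ∑ σ : Equiv.Perm (Fin m), ∑ f : Fin m → Fin n, if StrictMono f then F (f ∘ σ) else 0 := by
      rw [Finset.sum_comm]
      refine Finset.sum_congr rfl fun f _ => ?_
      split_ifs <;> simp
    _ = ∑ σ : Equiv.Perm (Fin m), ∑ f : Fin m → Fin n,
          if StrictMono (f ∘ σ.symm) then F f else 0 := by
      refine Finset.sum_congr rfl fun σ _ => ?_
      refine Fintype.sum_equiv (Equiv.arrowCongr σ.symm (Equiv.refl _)) _ _ fun f => ?_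
      have h : (f ∘ σ) ∘ σ.symm = f := by ext; simp
      change _ = if StrictMono ((f ∘ σ) ∘ σ.symm) then F (f ∘ σ) else 0
      rw [h]
    _ = ∑ f : Fin m → Fin n, ∑ σ : Equiv.Perm (Fin m),
          if StrictMono (f ∘ σ.symm) then F f else 0 := Finset.sum_comm
    _ = ∑ f, F f := by
      refine Finset.sum_congr rfl fun f _ => ?_
      by_cases hf : Function.Injective f
      · rw [Finset.sum_eq_single (Tuple.sort f).symm]
        · rw [if_pos]
          exact (Tuple.monotone_sort f).strictMono_of_injective
            (hf.comp (Tuple.sort f).symm.symm.injective)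
        · intro σ _ hσ
          refine if_neg fun h => hσ ?_
          have h2 := Tuple.unique_monotone h.monotone (Tuple.monotone_sort f)
          rw [← Equiv.symm_symm σ]
          congr 1
          exact Equiv.ext fun i => hf (congrFun h2 i)
        · simp
      · simp [hF f hf]

lemma alternating_eq_sum_strictMono_det {n m : ℕ} (T : Eucl n [⋀^Fin m]→ₗ[ℝ] ℝ)
    (v : Fin m → Eucl n) :
    (∑ f : Fin m → Fin n, if StrictMono f then
        T (fun i => e n (f i)) * (Matrix.of fun i j => v j (f i)).det else 0) = T v := by
  have key := sum_strictMono_sum_perm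
    (fun f : Fin m → Fin n => T (fun i => e n (f i)) * ∏ i, v i (f i)) (fun f hf => by
      have : T (fun i => e n (f i)) = 0 :=
        T.map_eq_zero_of_not_injective _ fun h =>
          hf fun i j hij => h (congrArg (e n) hij)
      simp only [this, zero_mul])
  have hv : v = fun i => ∑ j : Fin n, v i j • e n j := by
    ext1 i
    simpa [e] using ((EuclideanSpace.basisFun (Fin n) ℝ).sum_repr (v i)).symm
  have hT : T v = ∑ f : Fin m → Fin n, T (fun i => e n (f i)) * ∏ i, v i (f i) := by
    conv_lhs => rw [hv]
    have h1 := T.toMultilinearMap.map_sum (fun i (j : Fin n) => v i j • e n j)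
    refine h1.trans (Finset.sum_congr rfl fun f _ => ?_)
    rw [T.toMultilinearMap.map_smul_univ, smul_eq_mul, mul_comm]
    rfl
  rw [hT, ← key]
  refine Finset.sum_congr rfl fun f _ => ?_
  split_ifs with hf
  · rw [Matrix.det_apply', Finset.mul_sum]
    refine Finset.sum_congr rfl fun σ _ => ?_
    have h2 : T (fun i => e n ((f ∘ σ) i)) = Equiv.Perm.sign σ • T (fun i => e n (f i)) :=
      T.map_perm (fun i => e n (f i)) σ
    rw [h2, Units.smul_def, zsmul_eq_mul]
    simp only [Matrix.of_apply, Function.comp_apply]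
    ring
  · rfl

lemma sum_fin_four {n : ℕ} {M : Type*} [AddCommMonoid M] (F : (Fin 4 → Fin n) → M) :
    ∑ f, F f = ∑ k : Fin n, ∑ l : Fin n, ∑ a : Fin n, ∑ b : Fin n, F ![k, l, a, b] := by
  rw [← Fintype.sum_prod_type' fun k l => ∑ a : Fin n, ∑ b : Fin n, F ![k, l, a, b],
    ← Fintype.sum_prod_type' fun (p : Fin n × Fin n) a => ∑ b : Fin n, F ![p.1, p.2, a, b],
    ← Fintype.sum_prod_type' fun (p : (Fin n × Fin n) × Fin n) b => F ![p.1.1, p.1.2, p.2, b]]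
  refine Fintype.sum_equiv
    { toFun := fun f : Fin 4 → Fin n => (((f 0, f 1), f 2), f 3)
      invFun := fun p => ![p.1.1.1, p.1.1.2, p.1.2, p.2]
      left_inv := fun f => by ext i; fin_cases i <;> rfl
      right_inv := fun _ => rfl } _ _ fun f => ?_
  congr 1
  ext i
  fin_cases i <;> rfl

lemma strictMono_four_iff {n : ℕ} (k l a b : Fin n) :
    StrictMono ![k, l, a, b] ↔ k < l ∧ l < a ∧ a < b := by
  rw [Fin.strictMono_iff_lt_succ, Fin.forall_fin_succ, Fin.forall_fin_succ, Fin.forall_fin_succ]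
  simp

/-- The operator `∑_{k<l<a<b} T(e_k, e_l, e_a, e_b) ĉ(e_k) ĉ(e_l) ĉ(e_a) ĉ(e_b)`. -/
def quarticOp {n : ℕ} (T : Eucl n [⋀^Fin 4]→ₗ[ℝ] ℝ) : Module.End ℝ (ExtAlg n) :=
  ∑ f : Fin 4 → Fin n, if StrictMono f then T (fun i => e n (f i)) •
    (hc (e n (f 0)) * hc (e n (f 1)) * hc (e n (f 2)) * hc (e n (f 3))) else 0

lemma quarticOp_eq {n : ℕ} (T : Eucl n [⋀^Fin 4]→ₗ[ℝ] ℝ) :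
    quarticOp T = ∑ k : Fin n, ∑ l : Fin n, ∑ a : Fin n, ∑ b : Fin n,
      if k < l ∧ l < a ∧ a < b then
        T ![e n k, e n l, e n a, e n b] •
          (hc (e n k) * hc (e n l) * hc (e n a) * hc (e n b)) else 0 := by
  rw [quarticOp, sum_fin_four]
  have h : ∀ k l a b : Fin n,
      (fun i => e n (![k, l, a, b] i)) = ![e n k, e n l, e n a, e n b] := fun k l a b => by
    ext1 i
    fin_cases i <;> rfl
  simp only [strictMono_four_iff, h]
  rfl

lemma Tr_mul_quarticOp {n : ℕ} (T : Eucl n [⋀^Fin 4]→ₗ[ℝ] ℝ) (v : Fin 4 → Eucl n) :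
    Tr (hc (v 0) * hc (v 1) * hc (v 2) * hc (v 3) * quarticOp T) = 2 ^ n * T v := by
  rw [quarticOp, Finset.mul_sum, map_sum, ← alternating_eq_sum_strictMono_det T v, Finset.mul_sum]
  refine Finset.sum_congr rfl fun f _ => ?_
  split_ifs with hf
  · rw [mul_smul_comm, map_smul, Tr_hc_eight_eq_det v f hf.injective, smul_eq_mul]
    ring
  · simp

lemma c_commute_quarticOp {n : ℕ} (T : Eucl n [⋀^Fin 4]→ₗ[ℝ] ℝ) (x : Eucl n) :
    Commute (c x) (quarticOp T) := by
  refine Commute.sum_right _ _ _ fun f _ => ?_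
  split_ifs
  · refine Commute.smul_right ?_ _
    have h : ∀ y y' : Eucl n, Commute (c x) (hc y * hc y') := fun y y' => by
      rw [Commute, SemiconjBy, ← mul_assoc, c_mul_hc, smul_mul_assoc, mul_assoc, c_mul_hc,
        mul_smul_comm, smul_smul, mul_assoc]
      norm_num
    rw [mul_assoc]
    exact (h _ _).mul_right (h _ _)
  · exact Commute.zero_right _

lemma c_mul_self_of_mem_sphere {n : ℕ} (ξ : Metric.sphere (0 : Eucl n) 1) :
    c (ξ : Eucl n) * c (ξ : Eucl n) = (-1 : ℝ) • 1 := by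
  rw [c_mul_self, real_inner_self_eq_norm_sq, norm_eq_of_mem_sphere ξ, one_pow]

theorem stmt_17 (n : ℕ) (hn : 0 < n) (T : Eucl n [⋀^Fin 4]→ₗ[ℝ] ℝ) (u v w z : Eucl n)
    (Q : Module.End ℝ (ExtAlg n))
    (hQ : Q = ∑ k : Fin n, ∑ l : Fin n, ∑ a : Fin n, ∑ b : Fin n,
        if k < l ∧ l < a ∧ a < b then
          T ![e n k, e n l, e n a, e n b] •
            (hc (e n k) * hc (e n l) * hc (e n a) * hc (e n b)) else 0) :
    ((∫ ξ : Metric.sphere (0 : Eucl n) 1,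
        Tr (∑ i : Fin n, (ξ : Eucl n) i •
          (hc u * hc v * hc w * hc z * c (e n i) * Q * ∑ j : Fin n, (ξ : Eucl n) j • c (e n j)))
        ∂sphMeasure n) = -T ![u, v, w, z] * 2 ^ n * volSph n) ∧
    ((∫ ξ : Metric.sphere (0 : Eucl n) 1,
        Tr (∑ i : Fin n, (ξ : Eucl n) i •
          (hc u * hc v * hc w * hc z * Q * c (e n i) * ∑ j : Fin n, (ξ : Eucl n) j • c (e n j)))
        ∂sphMeasure n) = -T ![u, v, w, z] * 2 ^ n * volSph n) := by
  have hQ' : Q = quarticOp T := by rw [hQ, quarticOp_eq]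
  have hTr : Tr (hc u * hc v * hc w * hc z * Q) = 2 ^ n * T ![u, v, w, z] := by
    rw [hQ']
    exact Tr_mul_quarticOp T ![u, v, w, z]
  have hconst : ∫ _ξ : Metric.sphere (0 : Eucl n) 1,
      -(2 ^ n * T ![u, v, w, z]) ∂sphMeasure n = -T ![u, v, w, z] * 2 ^ n * volSph n := by
    rw [integral_const, smul_eq_mul, volSph, Measure.real]
    ring
  have hcomm (x : Eucl n) : c x * Q = Q * c x := by
    rw [hQ']
    exact c_commute_quarticOp T x
  have hfactor (A B C : Module.End ℝ (ExtAlg n)) (x : Eucl n) :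
      ∑ i : Fin n, x i • (A * c (e n i) * B * C) = A * c x * B * C := by
    rw [← sum_smul_c x]
    simp only [Finset.mul_sum, Finset.sum_mul, mul_smul_comm, smul_mul_assoc]
  have hsecond (ξ : Metric.sphere (0 : Eucl n) 1) :
      Tr (hc u * hc v * hc w * hc z * Q * c (ξ : Eucl n) * c (ξ : Eucl n)) =
        -(2 ^ n * T ![u, v, w, z]) := by
    rw [mul_assoc _ (c (ξ : Eucl n)), c_mul_self_of_mem_sphere, mul_smul_comm, mul_one,
      map_smul, hTr, smul_eq_mul, neg_one_mul]
  constructor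
  · rw [← hconst]
    congr 1 with ξ
    rw [hfactor, sum_smul_c, mul_assoc _ _ Q, hcomm, ← mul_assoc, hsecond]
  · rw [← hconst]
    congr 1 with ξ
    have h := hfactor (hc u * hc v * hc w * hc z * Q) 1 (c (ξ : Eucl n)) ξ
    simp only [mul_one] at h
    rw [sum_smul_c, h, hsecond]
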